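/- arXiv:1011.1839 — 2 statements merged into one kernel-verified Lean document; each statement's English description precedes it below -/
import Mathlib

section
/- Let A be an m×n real matrix whose two largest singular values satisfy σ₁(A) > σ₂(A), and set θ_A = (1/√(mn)) · (σ₁(A) − σ₂(A)) / (3σ₁(A) − σ₂(A)). Then for every θ with 0 ≤ θ < θ_A, the problem: maximize ⟨A,X⟩ subject to ‖X‖_θ ≤ 1, has a unique optimal solution, and this solution is a rank-one matrix. -/
open scoped BigOperators

noncomputable section

namespace LAROS

variable {m n : ℕ}

/-- Trace inner product `⟨A,X⟩ = trace(Aᵀ X)`. -/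
def mInner (A X : Matrix (Fin m) (Fin n) ℝ) : ℝ := ∑ i, ∑ j, A i j * X i j

/-- `N` is a norm on `m×n` real matrices. -/
def IsMatrixNorm (N : Matrix (Fin m) (Fin n) ℝ → ℝ) : Prop :=
  (∀ X, N X = 0 ↔ X = 0) ∧ (∀ (c : ℝ) (X), N (c • X) = |c| * N X) ∧
    (∀ X Y, N (X + Y) ≤ N X + N Y)

/-- Dual norm of `N`. -/
def dualNorm (N : Matrix (Fin m) (Fin n) ℝ → ℝ) (A : Matrix (Fin m) (Fin n) ℝ) : ℝ :=
  sSup {r | ∃ Y, N Y ≤ 1 ∧ r = mInner A Y}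

/-- `X` is optimal for: minimize `N X` subject to `⟨A,X⟩ ≥ 1`. -/
def IsOptMin (N : Matrix (Fin m) (Fin n) ℝ → ℝ) (A X : Matrix (Fin m) (Fin n) ℝ) : Prop :=
  1 ≤ mInner A X ∧ ∀ X', 1 ≤ mInner A X' → N X ≤ N X'

/-- `Y` is optimal for: maximize `⟨A,Y⟩` subject to `N Y ≤ 1`. -/
def IsOptMax (N : Matrix (Fin m) (Fin n) ℝ → ℝ) (A Y : Matrix (Fin m) (Fin n) ℝ) : Prop :=
  N Y ≤ 1 ∧ ∀ Y', N Y' ≤ 1 → mInner A Y' ≤ mInner A Y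

/-- Subdifferential of `f : ℝ^{m×n} → ℝ` at `A`, with respect to the trace inner product. -/
def subdiff (f : Matrix (Fin m) (Fin n) ℝ → ℝ) (A : Matrix (Fin m) (Fin n) ℝ) :
    Set (Matrix (Fin m) (Fin n) ℝ) :=
  {Y | ∀ B, f A + mInner (B - A) Y ≤ f B}

/-- The spectral norm (largest singular value) of an `m×n` real matrix. -/
def spectralNorm (A : Matrix (Fin m) (Fin n) ℝ) : ℝ :=
  sSup {r | ∃ (u : Fin m → ℝ) (v : Fin n → ℝ),
    (∑ i, u i ^ 2) ≤ 1 ∧ (∑ j, v j ^ 2) ≤ 1 ∧ r = ∑ i, ∑ j, u i * A i j * v j}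

/-- The nuclear norm (sum of singular values), as the dual norm of the spectral norm. -/
def nuclearNorm (A : Matrix (Fin m) (Fin n) ℝ) : ℝ := dualNorm spectralNorm A

/-- Entrywise ℓ1 norm: sum of absolute values of all entries. -/
def l1Norm (X : Matrix (Fin m) (Fin n) ℝ) : ℝ := ∑ i, ∑ j, |X i j|

/-- Entrywise max norm: maximum absolute value of an entry. -/
def maxNorm (X : Matrix (Fin m) (Fin n) ℝ) : ℝ := sSup {r | ∃ i j, r = |X i j|}

/-- The norm `‖X‖_θ = ‖X‖_* + θ‖X‖₁`. -/
def thetaNorm (θ : ℝ) (X : Matrix (Fin m) (Fin n) ℝ) : ℝ := nuclearNorm X + θ * l1Norm X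

/-- The second largest singular value, via best rank-one approximation:
`σ₂(A) = min { ‖A - S‖ : rank S ≤ 1 }`. -/
def sigma2 (A : Matrix (Fin m) (Fin n) ℝ) : ℝ :=
  sInf {r | ∃ S : Matrix (Fin m) (Fin n) ℝ, S.rank ≤ 1 ∧ r = spectralNorm (A - S)}

open Matrix

theorem mInner_comm (A X : Matrix (Fin m) (Fin n) ℝ) : mInner A X = mInner X A := by
  simp only [mInner, mul_comm]

theorem mInner_add_left (A B X : Matrix (Fin m) (Fin n) ℝ) :
    mInner (A + B) X = mInner A X + mInner B X := by
  simp [mInner, add_mul, Finset.sum_add_distrib]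

theorem mInner_sub_left (A B X : Matrix (Fin m) (Fin n) ℝ) :
    mInner (A - B) X = mInner A X - mInner B X := by
  simp [mInner, sub_mul, Finset.sum_sub_distrib]

theorem mInner_smul_left (c : ℝ) (A X : Matrix (Fin m) (Fin n) ℝ) :
    mInner (c • A) X = c * mInner A X := by
  simp [mInner, Finset.mul_sum, mul_assoc]

theorem mInner_smul_right (c : ℝ) (A X : Matrix (Fin m) (Fin n) ℝ) :
    mInner A (c • X) = c * mInner A X := by
  rw [mInner_comm, mInner_smul_left, mInner_comm]

theorem mInner_vecMulVec (A : Matrix (Fin m) (Fin n) ℝ) (u : Fin m → ℝ) (v : Fin n → ℝ) :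
    mInner A (vecMulVec u v) = u ⬝ᵥ (A *ᵥ v) := by
  simp only [mInner, vecMulVec_apply, dotProduct, mulVec, Finset.mul_sum]
  exact Finset.sum_congr rfl fun i _ => Finset.sum_congr rfl fun j _ => by ring

theorem mInner_self_nonneg (X : Matrix (Fin m) (Fin n) ℝ) : 0 ≤ mInner X X :=
  Finset.sum_nonneg fun _ _ => Finset.sum_nonneg fun _ _ => mul_self_nonneg _

theorem sq_apply_le_mInner_self (X : Matrix (Fin m) (Fin n) ℝ) (i : Fin m) (j : Fin n) :
    X i j ^ 2 ≤ mInner X X := by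
  rw [sq]
  exact (Finset.single_le_sum (f := fun j => X i j * X i j) (fun _ _ => mul_self_nonneg _)
    (Finset.mem_univ j)).trans (Finset.single_le_sum (f := fun i => ∑ j, X i j * X i j)
    (fun _ _ => Finset.sum_nonneg fun _ _ => mul_self_nonneg _) (Finset.mem_univ i))

theorem eq_zero_of_mInner_self_nonpos {X : Matrix (Fin m) (Fin n) ℝ} (h : mInner X X ≤ 0) :
    X = 0 := by
  ext i j
  exact pow_eq_zero_iff two_ne_zero |>.1 <|
    le_antisymm ((sq_apply_le_mInner_self X i j).trans h) (sq_nonneg _)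

theorem mInner_le_of_abs_le {c : ℝ} {Z : Matrix (Fin m) (Fin n) ℝ} (hZ : ∀ i j, |Z i j| ≤ c)
    (X : Matrix (Fin m) (Fin n) ℝ) : mInner Z X ≤ c * l1Norm X := by
  simp only [mInner, l1Norm, Finset.mul_sum]
  refine Finset.sum_le_sum fun i _ => Finset.sum_le_sum fun j _ => ?_
  calc Z i j * X i j ≤ |Z i j * X i j| := le_abs_self _
    _ = |Z i j| * |X i j| := abs_mul _ _
    _ ≤ c * |X i j| := mul_le_mul_of_nonneg_right (hZ i j) (abs_nonneg _)

theorem l1Norm_nonneg (X : Matrix (Fin m) (Fin n) ℝ) : 0 ≤ l1Norm X :=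
  Finset.sum_nonneg fun _ _ => Finset.sum_nonneg fun _ _ => abs_nonneg _

theorem l1Norm_smul (c : ℝ) (X : Matrix (Fin m) (Fin n) ℝ) : l1Norm (c • X) = |c| * l1Norm X := by
  simp [l1Norm, Finset.mul_sum, abs_mul]

theorem continuous_mInner (A : Matrix (Fin m) (Fin n) ℝ) : Continuous (mInner A) := by
  unfold mInner
  fun_prop

theorem continuous_l1Norm :
    Continuous (l1Norm : Matrix (Fin m) (Fin n) ℝ → ℝ) := by
  unfold l1Norm
  fun_prop

/-- Every linear functional on matrices is a trace inner product. -/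
theorem exists_mInner_eq (f : Matrix (Fin m) (Fin n) ℝ →ₗ[ℝ] ℝ) :
    ∃ W : Matrix (Fin m) (Fin n) ℝ, ∀ X, f X = mInner X W := by
  refine ⟨fun i j => f (Matrix.single i j 1), fun X => ?_⟩
  conv_lhs => rw [matrix_eq_sum_single X]
  simp only [map_sum, mInner]
  refine Finset.sum_congr rfl fun i _ => Finset.sum_congr rfl fun j _ => ?_
  rw [← smul_eq_mul, ← map_smul, smul_single, smul_eq_mul, mul_one]

theorem dotProduct_self_nonneg_real {k : ℕ} (u : Fin k → ℝ) : 0 ≤ u ⬝ᵥ u :=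
  Finset.sum_nonneg fun _ _ => mul_self_nonneg _

theorem dotProduct_le_of_sq_le {k : ℕ} {u w : Fin k → ℝ} {c : ℝ} (hc : 0 ≤ c) (hu : u ⬝ᵥ u ≤ 1)
    (hw : w ⬝ᵥ w ≤ c ^ 2) : u ⬝ᵥ w ≤ c := by
  have h := dotProduct_self_nonneg_real (c • u - w)
  simp only [sub_dotProduct, dotProduct_sub, smul_dotProduct, dotProduct_smul, smul_eq_mul,
    dotProduct_comm w u] at h
  rcases hc.eq_or_lt with rfl | hc
  · have : w = 0 := dotProduct_self_eq_zero.1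
      (le_antisymm (by simpa using hw) (dotProduct_self_nonneg_real w))
    simp [this]
  · nlinarith [mul_le_mul_of_nonneg_left hu (sq_nonneg c)]

theorem isCompact_unitBall (k : ℕ) : IsCompact {u : Fin k → ℝ | u ⬝ᵥ u ≤ 1} := by
  refine (isCompact_univ_pi fun _ : Fin k =>
    isCompact_Icc (a := (-1 : ℝ)) (b := 1)).of_isClosed_subset
      (isClosed_le (by unfold dotProduct; fun_prop) continuous_const) fun u hu i _ => ?_
  have h : u i * u i ≤ 1 := (Finset.single_le_sum (f := fun i => u i * u i)
    (fun _ _ => mul_self_nonneg _) (Finset.mem_univ i)).trans hu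
  constructor <;> nlinarith

theorem exists_isMaxOn_bilinear (A : Matrix (Fin m) (Fin n) ℝ) :
    ∃ u : Fin m → ℝ, ∃ v : Fin n → ℝ, u ⬝ᵥ u ≤ 1 ∧ v ⬝ᵥ v ≤ 1 ∧
      ∀ u' v', u' ⬝ᵥ u' ≤ 1 → v' ⬝ᵥ v' ≤ 1 → u' ⬝ᵥ (A *ᵥ v') ≤ u ⬝ᵥ (A *ᵥ v) := by
  obtain ⟨p, hp, hmax⟩ := ((isCompact_unitBall m).prod (isCompact_unitBall n)).exists_isMaxOn
    ⟨(0, 0), by simp⟩ (f := fun p => p.1 ⬝ᵥ (A *ᵥ p.2))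
    (by unfold dotProduct mulVec dotProduct; fun_prop)
  exact ⟨p.1, p.2, hp.1, hp.2, fun u' v' hu hv => hmax (Set.mk_mem_prod hu hv)⟩

theorem spectralNorm_eq_sSup (A : Matrix (Fin m) (Fin n) ℝ) :
    spectralNorm A = sSup {r | ∃ (u : Fin m → ℝ) (v : Fin n → ℝ),
      u ⬝ᵥ u ≤ 1 ∧ v ⬝ᵥ v ≤ 1 ∧ r = u ⬝ᵥ (A *ᵥ v)} := by
  simp only [spectralNorm, dotProduct, mulVec, Finset.mul_sum, sq, mul_assoc]

theorem exists_spectralNorm_eq (A : Matrix (Fin m) (Fin n) ℝ) :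
    ∃ u : Fin m → ℝ, ∃ v : Fin n → ℝ, u ⬝ᵥ u ≤ 1 ∧ v ⬝ᵥ v ≤ 1 ∧
      u ⬝ᵥ (A *ᵥ v) = spectralNorm A ∧
      ∀ u' v', u' ⬝ᵥ u' ≤ 1 → v' ⬝ᵥ v' ≤ 1 → u' ⬝ᵥ (A *ᵥ v') ≤ spectralNorm A := by
  obtain ⟨u, v, hu, hv, hmax⟩ := exists_isMaxOn_bilinear A
  have : IsGreatest {r | ∃ (u : Fin m → ℝ) (v : Fin n → ℝ),
      u ⬝ᵥ u ≤ 1 ∧ v ⬝ᵥ v ≤ 1 ∧ r = u ⬝ᵥ (A *ᵥ v)} (u ⬝ᵥ (A *ᵥ v)) :=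
    ⟨⟨u, v, hu, hv, rfl⟩, by rintro _ ⟨u', v', hu', hv', rfl⟩; exact hmax u' v' hu' hv'⟩
  have h := this.csSup_eq
  rw [← spectralNorm_eq_sSup] at h
  exact ⟨u, v, hu, hv, h.symm, h ▸ hmax⟩

theorem le_spectralNorm (A : Matrix (Fin m) (Fin n) ℝ) {u : Fin m → ℝ} {v : Fin n → ℝ}
    (hu : u ⬝ᵥ u ≤ 1) (hv : v ⬝ᵥ v ≤ 1) : u ⬝ᵥ (A *ᵥ v) ≤ spectralNorm A := by
  obtain ⟨_, _, _, _, _, h⟩ := exists_spectralNorm_eq A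
  exact h u v hu hv

theorem spectralNorm_le {A : Matrix (Fin m) (Fin n) ℝ} {c : ℝ}
    (h : ∀ u v, u ⬝ᵥ u ≤ 1 → v ⬝ᵥ v ≤ 1 → u ⬝ᵥ (A *ᵥ v) ≤ c) : spectralNorm A ≤ c := by
  obtain ⟨u, v, hu, hv, he, _⟩ := exists_spectralNorm_eq A
  exact he ▸ h u v hu hv

theorem spectralNorm_nonneg (A : Matrix (Fin m) (Fin n) ℝ) : 0 ≤ spectralNorm A := by
  simpa using le_spectralNorm A (u := 0) (v := 0) (by simp) (by simp)

theorem spectralNorm_le_of_mulVec_sq_le {A : Matrix (Fin m) (Fin n) ℝ} {c : ℝ} (hc : 0 ≤ c)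
    (h : ∀ v, (A *ᵥ v) ⬝ᵥ (A *ᵥ v) ≤ c ^ 2 * (v ⬝ᵥ v)) : spectralNorm A ≤ c :=
  spectralNorm_le fun _ v hu hv => dotProduct_le_of_sq_le hc hu <|
    (h v).trans (mul_le_of_le_one_right (sq_nonneg c) hv)

theorem dotProduct_smul_inv_sqrt {k : ℕ} {v : Fin k → ℝ} (hv : 0 < v ⬝ᵥ v) :
    ((√(v ⬝ᵥ v))⁻¹ • v) ⬝ᵥ ((√(v ⬝ᵥ v))⁻¹ • v) = 1 := by
  have h := Real.sq_sqrt hv.le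
  have h' := Real.sqrt_pos.2 hv
  rw [smul_dotProduct, dotProduct_smul, smul_eq_mul, smul_eq_mul]
  nth_rewrite 3 [← h]
  field_simp

theorem mulVec_sq_le {A : Matrix (Fin m) (Fin n) ℝ} {c : ℝ} (hA : spectralNorm A ≤ c)
    (v : Fin n → ℝ) : (A *ᵥ v) ⬝ᵥ (A *ᵥ v) ≤ c ^ 2 * (v ⬝ᵥ v) := by
  rcases (dotProduct_self_nonneg_real v).eq_or_lt with hv | hv
  · simp [dotProduct_self_eq_zero.1 hv.symm]
  rcases (dotProduct_self_nonneg_real (A *ᵥ v)).eq_or_lt with hw | hw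
  · rw [← hw]; positivity
  have h := (le_spectralNorm A (dotProduct_smul_inv_sqrt hw).le
    (dotProduct_smul_inv_sqrt hv).le).trans hA
  rw [mulVec_smul, smul_dotProduct, dotProduct_smul, smul_eq_mul, smul_eq_mul] at h
  have h1 := Real.sq_sqrt hw.le
  have h1' := Real.sqrt_pos.2 hw
  have h2 := Real.sq_sqrt hv.le
  have h2' := Real.sqrt_pos.2 hv
  set a := √((A *ᵥ v) ⬝ᵥ (A *ᵥ v))
  set b := √(v ⬝ᵥ v)
  rw [← h1] at h ⊢
  rw [← h2]
  have h3 : a ≤ c * b := by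
    have : a⁻¹ * (b⁻¹ * a ^ 2) = a / b := by field_simp
    rwa [this, div_le_iff₀ h2'] at h
  calc a ^ 2 ≤ (c * b) ^ 2 := pow_le_pow_left₀ h1'.le h3 2
    _ = c ^ 2 * b ^ 2 := by ring

theorem spectralNorm_smul_le {c : ℝ} (hc : 0 ≤ c) (A : Matrix (Fin m) (Fin n) ℝ) :
    spectralNorm (c • A) ≤ c * spectralNorm A :=
  spectralNorm_le fun u v hu hv => by
    rw [smul_mulVec, dotProduct_smul, smul_eq_mul]
    exact mul_le_mul_of_nonneg_left (le_spectralNorm A hu hv) hc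

theorem spectralNorm_add_le (A B : Matrix (Fin m) (Fin n) ℝ) :
    spectralNorm (A + B) ≤ spectralNorm A + spectralNorm B :=
  spectralNorm_le fun u v hu hv => by
    rw [add_mulVec, dotProduct_add]
    exact add_le_add (le_spectralNorm A hu hv) (le_spectralNorm B hu hv)

theorem spectralNorm_neg_le (A : Matrix (Fin m) (Fin n) ℝ) :
    spectralNorm (-A) ≤ spectralNorm A :=
  spectralNorm_le fun u v hu hv => by
    rw [neg_mulVec, dotProduct_neg, ← neg_dotProduct]
    exact le_spectralNorm A (by simpa using hu) hv

/-- The spectral norm is dominated by the Frobenius norm. -/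
theorem spectralNorm_le_of_mInner_self_le {A : Matrix (Fin m) (Fin n) ℝ} {c : ℝ} (hc : 0 ≤ c)
    (hA : mInner A A ≤ c ^ 2) : spectralNorm A ≤ c := by
  refine spectralNorm_le_of_mulVec_sq_le hc fun v => ?_
  refine le_trans ?_ (mul_le_mul_of_nonneg_right hA (dotProduct_self_nonneg_real v))
  simp only [mInner, Finset.sum_mul, dotProduct, mulVec]
  have := fun i => Finset.sum_mul_sq_le_sq_mul_sq Finset.univ (A i) v
  simp only [sq] at this
  simpa only [Finset.sum_mul] using Finset.sum_le_sum fun i (_ : i ∈ Finset.univ) => this i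

theorem abs_apply_le_spectralNorm (A : Matrix (Fin m) (Fin n) ℝ) (i : Fin m) (j : Fin n) :
    |A i j| ≤ spectralNorm A := by
  refine abs_le'.2 ⟨?_, ?_⟩
  · simpa using le_spectralNorm A (u := Pi.single i 1) (v := Pi.single j 1) (by simp) (by simp)
  · simpa using le_spectralNorm A (u := -Pi.single i 1) (v := Pi.single j 1) (by simp) (by simp)

theorem mInner_le_nuclearNorm (X : Matrix (Fin m) (Fin n) ℝ) {Y : Matrix (Fin m) (Fin n) ℝ}
    (hY : spectralNorm Y ≤ 1) : mInner X Y ≤ nuclearNorm X := by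
  refine le_csSup ⟨1 * l1Norm X, ?_⟩ ⟨Y, hY, rfl⟩
  rintro _ ⟨W, hW, rfl⟩
  rw [mInner_comm]
  exact mInner_le_of_abs_le (fun i j => (abs_apply_le_spectralNorm W i j).trans hW) X

theorem spectralNorm_zero_le : spectralNorm (0 : Matrix (Fin m) (Fin n) ℝ) ≤ 0 :=
  spectralNorm_le fun _ _ _ _ => by simp

theorem nuclearNorm_le {X : Matrix (Fin m) (Fin n) ℝ} {c : ℝ}
    (h : ∀ Y, spectralNorm Y ≤ 1 → mInner X Y ≤ c) : nuclearNorm X ≤ c := by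
  refine csSup_le ⟨_, 0, spectralNorm_zero_le.trans zero_le_one, rfl⟩ ?_
  rintro _ ⟨Y, hY, rfl⟩
  exact h Y hY

theorem mInner_le_mul_nuclearNorm {Y : Matrix (Fin m) (Fin n) ℝ} {c : ℝ} (hc : 0 < c)
    (hY : spectralNorm Y ≤ c) (X : Matrix (Fin m) (Fin n) ℝ) :
    mInner Y X ≤ c * nuclearNorm X := by
  have h := mInner_le_nuclearNorm X (Y := c⁻¹ • Y)
    ((spectralNorm_smul_le (inv_nonneg.2 hc.le) Y).trans (by
      rw [inv_mul_le_iff₀ hc]; simpa using hY))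
  rwa [mInner_smul_right, inv_mul_le_iff₀ hc, mInner_comm] at h

theorem nuclearNorm_nonneg (X : Matrix (Fin m) (Fin n) ℝ) : 0 ≤ nuclearNorm X := by
  simpa [mInner] using mInner_le_nuclearNorm X (spectralNorm_zero_le.trans zero_le_one)

/-- The Frobenius norm is dominated by the nuclear norm. -/
theorem mInner_self_le_nuclearNorm_sq (X : Matrix (Fin m) (Fin n) ℝ) :
    mInner X X ≤ nuclearNorm X ^ 2 := by
  rcases (mInner_self_nonneg X).eq_or_lt with h | h
  · rw [← h]; positivity
  have h1 := Real.sq_sqrt h.le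
  have h2 := Real.sqrt_pos.2 h
  have h3 := mInner_le_mul_nuclearNorm h2 (spectralNorm_le_of_mInner_self_le h2.le h1.ge) X
  nlinarith

theorem eq_zero_of_nuclearNorm_nonpos {X : Matrix (Fin m) (Fin n) ℝ} (h : nuclearNorm X ≤ 0) :
    X = 0 := by
  have := mInner_self_le_nuclearNorm_sq X
  rw [le_antisymm h (nuclearNorm_nonneg X)] at this
  exact eq_zero_of_mInner_self_nonpos (by simpa using this)

theorem abs_apply_le_nuclearNorm (X : Matrix (Fin m) (Fin n) ℝ) (i : Fin m) (j : Fin n) :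
    |X i j| ≤ nuclearNorm X :=
  abs_le_of_sq_le_sq ((sq_apply_le_mInner_self X i j).trans (mInner_self_le_nuclearNorm_sq X))
    (nuclearNorm_nonneg X)

theorem nuclearNorm_smul_le {c : ℝ} (hc : 0 ≤ c) (X : Matrix (Fin m) (Fin n) ℝ) :
    nuclearNorm (c • X) ≤ c * nuclearNorm X :=
  nuclearNorm_le fun Y hY => by
    rw [mInner_smul_left]
    exact mul_le_mul_of_nonneg_left (mInner_le_nuclearNorm X hY) hc

theorem exists_smul_add_smul_mulVec_eq_zero {S : Matrix (Fin m) (Fin n) ℝ} (hS : S.rank ≤ 1)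
    (v w : Fin n → ℝ) : ∃ α β : ℝ, (α ≠ 0 ∨ β ≠ 0) ∧ S *ᵥ (α • v + β • w) = 0 := by
  obtain ⟨g, hg⟩ := finrank_le_one_iff.1 hS
  obtain ⟨a, ha⟩ := hg ⟨S.mulVecLin v, v, rfl⟩
  obtain ⟨b, hb⟩ := hg ⟨S.mulVecLin w, w, rfl⟩
  have ha' : S *ᵥ v = a • (g : Fin m → ℝ) := (congrArg Subtype.val ha).symm
  have hb' : S *ᵥ w = b • (g : Fin m → ℝ) := (congrArg Subtype.val hb).symm
  by_cases h : b = 0 ∧ a = 0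
  · exact ⟨1, 0, Or.inl one_ne_zero, by simp [ha', h.2]⟩
  · refine ⟨b, -a, by simpa only [ne_eq, neg_eq_zero, not_and_or] using h, ?_⟩
    rw [mulVec_add, mulVec_smul, mulVec_smul, ha', hb', smul_smul, smul_smul, ← add_smul]
    simp [mul_comm]

/-- A pair of unit vectors attaining the spectral norm consists of singular vectors. -/
theorem mulVec_eq_smul_of_attains {Y : Matrix (Fin m) (Fin n) ℝ} {t : ℝ} (hY : spectralNorm Y ≤ t)
    {u : Fin m → ℝ} {v : Fin n → ℝ} (hu : u ⬝ᵥ u ≤ 1) (hv : v ⬝ᵥ v ≤ 1)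
    (h : u ⬝ᵥ (Y *ᵥ v) = t) : Y *ᵥ v = t • u := by
  have h1 := mulVec_sq_le hY v
  have h2 : (Y *ᵥ v - t • u) ⬝ᵥ (Y *ᵥ v - t • u) ≤ 0 := by
    simp only [sub_dotProduct, dotProduct_sub, smul_dotProduct, dotProduct_smul, smul_eq_mul,
      dotProduct_comm (Y *ᵥ v) u, h]
    nlinarith [mul_le_mul_of_nonneg_left hu (sq_nonneg t),
      mul_le_mul_of_nonneg_left hv (sq_nonneg t)]
  exact sub_eq_zero.1 (dotProduct_self_eq_zero.1 (le_antisymm h2 (dotProduct_self_nonneg_real _)))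

theorem spectralNorm_transpose_le (A : Matrix (Fin m) (Fin n) ℝ) :
    spectralNorm Aᵀ ≤ spectralNorm A :=
  spectralNorm_le fun u v hu hv => by
    rw [mulVec_transpose, dotProduct_comm, ← dotProduct_mulVec]
    exact le_spectralNorm A hv hu

/-- If `Y` is within spectral distance `τ < t` of a rank-one matrix and `u`, `v` are unit singular
vectors for the singular value `t = ‖Y‖`, then the remaining singular values are at most `τ`. -/
theorem spectralNorm_sub_smul_vecMulVec_le {Y S : Matrix (Fin m) (Fin n) ℝ} {t τ : ℝ}
    (hY : spectralNorm Y ≤ t) (hS : S.rank ≤ 1) (hτ : 0 < τ) (hτt : τ < t)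
    (hYS : spectralNorm (Y - S) ≤ τ) {u : Fin m → ℝ} {v : Fin n → ℝ} (hu : u ⬝ᵥ u ≤ 1)
    (hv : v ⬝ᵥ v ≤ 1) (h : u ⬝ᵥ (Y *ᵥ v) = t) :
    spectralNorm (Y - (t - τ) • vecMulVec u v) ≤ τ := by
  have ht : 0 < t := hτ.trans hτt
  have hYv := mulVec_eq_smul_of_attains hY hu hv h
  have hYu : Yᵀ *ᵥ u = t • v := mulVec_eq_smul_of_attains
    ((spectralNorm_transpose_le Y).trans hY) hv hu (by
      rw [mulVec_transpose, dotProduct_comm, ← dotProduct_mulVec, h])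
  have hu1 : u ⬝ᵥ u = 1 := by
    rw [hYv, dotProduct_smul, smul_eq_mul] at h
    exact mul_left_cancel₀ ht.ne' (by rw [h, mul_one])
  have huY : ∀ w, u ⬝ᵥ (Y *ᵥ w) = t * (v ⬝ᵥ w) := fun w => by
    rw [dotProduct_mulVec, ← mulVec_transpose, hYu, smul_dotProduct, smul_eq_mul]
  have hv1 : v ⬝ᵥ v = 1 := by
    have := huY v
    rw [h] at this
    exact mul_left_cancel₀ ht.ne' (by rw [← this, mul_one])
  have hsq : 0 < t ^ 2 - τ ^ 2 := by nlinarith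
  refine spectralNorm_le_of_mulVec_sq_le hτ.le fun w => ?_
  have key : (Y *ᵥ w) ⬝ᵥ (Y *ᵥ w) ≤ τ ^ 2 * (w ⬝ᵥ w) + (t ^ 2 - τ ^ 2) * (v ⬝ᵥ w) ^ 2 := by
    obtain ⟨α, β, hαβ, hz⟩ := exists_smul_add_smul_mulVec_eq_zero hS v w
    have h1 := mulVec_sq_le hYS (α • v + β • w)
    rw [sub_mulVec, hz, sub_zero, mulVec_add, mulVec_smul, mulVec_smul, hYv] at h1
    simp only [add_dotProduct, dotProduct_add, smul_dotProduct, dotProduct_smul, smul_eq_mul,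
      dotProduct_comm (Y *ᵥ w) u, dotProduct_comm w v, huY, hu1, hv1] at h1
    by_cases hβ : β = 0
    · subst hβ
      have hα : 0 < α ^ 2 := by
        have : α ≠ 0 := by simpa using hαβ
        positivity
      nlinarith [mul_pos hα hsq]
    · have hβ' : 0 < β ^ 2 := by positivity
      refine le_of_mul_le_mul_left ?_ hβ'
      nlinarith [mul_nonneg hsq.le (sq_nonneg (α + β * (v ⬝ᵥ w)))]
  have hM : (Y - (t - τ) • vecMulVec u v) *ᵥ w = Y *ᵥ w - ((t - τ) * (v ⬝ᵥ w)) • u := by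
    ext i
    simp only [sub_mulVec, smul_mulVec, vecMulVec_mulVec, Pi.sub_apply, Pi.smul_apply, smul_eq_mul,
      op_smul_eq_smul, mul_assoc]
  rw [hM]
  simp only [sub_dotProduct, dotProduct_sub, smul_dotProduct, dotProduct_smul, smul_eq_mul,
    dotProduct_comm (Y *ᵥ w) u, huY, hu1]
  nlinarith

/-- Equality case of `⟨Y, X⟩ ≤ ‖Y‖ ‖X‖_*` when the top singular value of `Y` is simple. -/
theorem eq_smul_vecMulVec_of_mInner_eq {Y S : Matrix (Fin m) (Fin n) ℝ} {t τ : ℝ}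
    (hY : spectralNorm Y ≤ t) (hS : S.rank ≤ 1) (hτ : 0 < τ) (hτt : τ < t)
    (hYS : spectralNorm (Y - S) ≤ τ) {u : Fin m → ℝ} {v : Fin n → ℝ} (hu : u ⬝ᵥ u ≤ 1)
    (hv : v ⬝ᵥ v ≤ 1) (h : u ⬝ᵥ (Y *ᵥ v) = t) {X : Matrix (Fin m) (Fin n) ℝ}
    (hX : mInner Y X = t * nuclearNorm X) : X = nuclearNorm X • vecMulVec u v := by
  have h1 := mInner_le_mul_nuclearNorm hτ
    (spectralNorm_sub_smul_vecMulVec_le hY hS hτ hτt hYS hu hv h) X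
  rw [mInner_sub_left, mInner_smul_left, hX] at h1
  have h2 : nuclearNorm X ≤ mInner (vecMulVec u v) X := by
    refine le_of_mul_le_mul_left ?_ (sub_pos.2 hτt)
    linarith
  have h3 := mInner_self_le_nuclearNorm_sq X
  have h4 : mInner (vecMulVec u v) (vecMulVec u v) ≤ 1 := by
    rw [mInner_vecMulVec, vecMulVec_mulVec, op_smul_eq_smul, dotProduct_smul, smul_eq_mul]
    exact mul_le_one₀ hv (dotProduct_self_nonneg_real u) hu
  refine sub_eq_zero.1 (eq_zero_of_mInner_self_nonpos ?_)
  set k := vecMulVec u v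
  set r := nuclearNorm X
  have h5 : mInner (X - r • k) (X - r • k) =
      mInner X X - 2 * r * mInner k X + r ^ 2 * mInner k k := by
    rw [mInner_sub_left, mInner_comm X, mInner_comm (r • k), mInner_sub_left, mInner_sub_left]
    simp only [mInner_smul_left, mInner_smul_right, mInner_comm X k]
    ring
  have hr : 0 ≤ r := nuclearNorm_nonneg X
  rw [h5]
  nlinarith [mul_le_mul_of_nonneg_left h4 (sq_nonneg r), mul_le_mul_of_nonneg_left h2 hr]

theorem thetaNorm_smul_le (θ : ℝ) {c : ℝ} (hc : 0 ≤ c)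
    (X : Matrix (Fin m) (Fin n) ℝ) : thetaNorm θ (c • X) ≤ c * thetaNorm θ X := by
  rw [thetaNorm, thetaNorm, l1Norm_smul, abs_of_nonneg hc]
  linarith [nuclearNorm_smul_le hc X]

theorem isCompact_thetaNorm_le_one {θ : ℝ} (hθ : 0 ≤ θ) :
    IsCompact {X : Matrix (Fin m) (Fin n) ℝ | thetaNorm θ X ≤ 1} := by
  have heq : {X : Matrix (Fin m) (Fin n) ℝ | thetaNorm θ X ≤ 1} =
      ⋂ Y ∈ {Y : Matrix (Fin m) (Fin n) ℝ | spectralNorm Y ≤ 1},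
        {X | mInner Y X + θ * l1Norm X ≤ 1} := by
    ext X
    simp only [thetaNorm, Set.mem_iInter, Set.mem_ofPred_eq]
    refine ⟨fun h Y hY => ?_, fun h => ?_⟩
    · rw [mInner_comm]
      linarith [mInner_le_nuclearNorm X hY]
    · have := nuclearNorm_le (X := X) (c := 1 - θ * l1Norm X) fun Y hY => by
        rw [mInner_comm]; linarith [h Y hY]
      linarith
  have hK : IsCompact (Set.univ.pi fun _ => Set.univ.pi fun _ => Set.Icc (-1) 1 :
      Set (Fin m → Fin n → ℝ)) :=
    isCompact_univ_pi fun _ => isCompact_univ_pi fun _ => isCompact_Icc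
  refine IsCompact.of_isClosed_subset (X := Matrix (Fin m) (Fin n) ℝ) hK ?_ fun X hX i _ j _ => ?_
  · rw [heq]
    exact isClosed_biInter fun Y _ => isClosed_le
      ((continuous_mInner Y).add (continuous_const.mul continuous_l1Norm)) continuous_const
  · have h1 : nuclearNorm X + θ * l1Norm X ≤ 1 := hX
    exact abs_le.1 ((abs_apply_le_nuclearNorm X i j).trans
      (by linarith [mul_nonneg hθ (l1Norm_nonneg X)]))

theorem thetaNorm_nonneg {θ : ℝ} (hθ : 0 ≤ θ) (X : Matrix (Fin m) (Fin n) ℝ) :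
    0 ≤ thetaNorm θ X :=
  add_nonneg (nuclearNorm_nonneg X) (mul_nonneg hθ (l1Norm_nonneg X))

theorem exists_isOptMax {θ : ℝ} (hθ : 0 ≤ θ) (A : Matrix (Fin m) (Fin n) ℝ) :
    ∃ X, IsOptMax (thetaNorm θ) A X := by
  have h0 : thetaNorm θ (0 : Matrix (Fin m) (Fin n) ℝ) ≤ 1 := by
    have h := thetaNorm_smul_le θ le_rfl (0 : Matrix (Fin m) (Fin n) ℝ)
    rw [smul_zero, zero_mul] at h
    exact h.trans zero_le_one
  obtain ⟨X, hX, hmax⟩ := (isCompact_thetaNorm_le_one (m := m) (n := n) hθ).exists_isMaxOn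
    ⟨0, h0⟩ (continuous_mInner A).continuousOn
  exact ⟨X, hX, fun Y hY => hmax hY⟩

theorem IsOptMax.mInner_le {θ : ℝ} (hθ : 0 ≤ θ) {A X : Matrix (Fin m) (Fin n) ℝ}
    (hX : IsOptMax (thetaNorm θ) A X) (Y : Matrix (Fin m) (Fin n) ℝ) :
    mInner A Y ≤ mInner A X * thetaNorm θ Y := by
  rcases (thetaNorm_nonneg hθ Y).eq_or_lt with h | h
  · have h0 : nuclearNorm Y ≤ 0 := by
      have : nuclearNorm Y + θ * l1Norm Y = 0 := h.symm
      linarith [mul_nonneg hθ (l1Norm_nonneg Y)]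
    rw [← h, eq_zero_of_nuclearNorm_nonpos h0]
    simp [mInner]
  · have h1 := hX.2 ((thetaNorm θ Y)⁻¹ • Y) ((thetaNorm_smul_le θ (inv_nonneg.2 h.le) Y).trans
      (inv_mul_cancel₀ h.ne').le)
    rw [mInner_smul_right, inv_mul_le_iff₀ h] at h1
    linarith

theorem exists_mInner_eq_l1Norm {c : ℝ} (hc : 0 ≤ c) (X : Matrix (Fin m) (Fin n) ℝ) :
    ∃ Z : Matrix (Fin m) (Fin n) ℝ, (∀ i j, |Z i j| ≤ c) ∧ mInner Z X = c * l1Norm X := by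
  refine ⟨fun i j => c * SignType.sign (X i j), fun i j => ?_, ?_⟩
  · rw [abs_mul, abs_of_nonneg hc]
    refine mul_le_of_le_one_right hc ?_
    rcases lt_trichotomy (X i j) 0 with h | h | h <;> simp [h]
  · simp only [mInner, l1Norm, Finset.mul_sum, mul_assoc, sign_mul_self]

open scoped Pointwise in
/-- A functional dominated by `t ‖·‖_θ` splits into one dominated by `t ‖·‖_*` and one dominated
by `t θ ‖·‖₁`. -/
theorem exists_add_eq_of_mInner_le {θ t : ℝ} (hθ : 0 ≤ θ) (ht : 0 < t)
    {A : Matrix (Fin m) (Fin n) ℝ} (hA : ∀ X, mInner A X ≤ t * thetaNorm θ X) :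
    ∃ Y Z : Matrix (Fin m) (Fin n) ℝ, spectralNorm Y ≤ t ∧ (∀ i j, |Z i j| ≤ t * θ) ∧
      Y + Z = A := by
  let C : Set (Matrix (Fin m) (Fin n) ℝ) := {Y | spectralNorm Y ≤ t}
  let D : Set (Matrix (Fin m) (Fin n) ℝ) := {Z | ∀ i j, |Z i j| ≤ t * θ}
  have hC : IsClosed C := by
    have : C = ⋂ u ∈ {u : Fin m → ℝ | u ⬝ᵥ u ≤ 1}, ⋂ v ∈ {v : Fin n → ℝ | v ⬝ᵥ v ≤ 1},
        {Y | mInner (vecMulVec u v) Y ≤ t} := by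
      ext Y
      simp only [C, Set.mem_iInter, Set.mem_ofPred_eq, mInner_comm _ Y, mInner_vecMulVec]
      exact ⟨fun h u hu v hv => (le_spectralNorm Y hu hv).trans h,
        fun h => spectralNorm_le fun u v hu hv => h u hu v hv⟩
    rw [this]
    exact isClosed_biInter fun u _ => isClosed_biInter fun v _ =>
      isClosed_le (continuous_mInner _) continuous_const
  have hCc : Convex ℝ C := by
    intro Y hY W hW a b ha hb hab
    refine (spectralNorm_add_le _ _).trans <| (add_le_add (spectralNorm_smul_le ha Y)
      (spectralNorm_smul_le hb W)).trans ?_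
    calc a * spectralNorm Y + b * spectralNorm W ≤ a * t + b * t :=
          add_le_add (mul_le_mul_of_nonneg_left hY ha) (mul_le_mul_of_nonneg_left hW hb)
      _ = t := by rw [← add_mul, hab, one_mul]
  have hDpi : D = (Set.univ.pi fun _ => Set.univ.pi fun _ => Set.Icc (-(t * θ)) (t * θ) :
      Set (Fin m → Fin n → ℝ)) := by
    ext Z
    exact ⟨fun h i _ j _ => abs_le.1 (h i j), fun h i j => abs_le.2 (h i trivial j trivial)⟩
  have hD : IsCompact D := hDpi ▸
    isCompact_univ_pi fun _ => isCompact_univ_pi fun _ => isCompact_Icc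
  have hDc : Convex ℝ D := hDpi ▸ convex_pi fun _ _ => convex_pi fun _ _ => convex_Icc _ _
  by_contra hne
  have hmem : A ∉ C + D := fun ⟨Y, hY, Z, hZ, h⟩ => hne ⟨Y, Z, hY, hZ, h⟩
  have : LocallyConvexSpace ℝ (Matrix (Fin m) (Fin n) ℝ) :=
    inferInstanceAs (LocallyConvexSpace ℝ (Fin m → Fin n → ℝ))
  obtain ⟨f, c, hf, hfA⟩ := geometric_hahn_banach_closed_point (hCc.add hDc)
    (hC.add_right_of_isCompact hD) hmem
  obtain ⟨X, hX⟩ := exists_mInner_eq f.toLinearMap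
  have hX' : ∀ W, f W = mInner W X := hX
  obtain ⟨Z, hZ, hZX⟩ := exists_mInner_eq_l1Norm (mul_nonneg ht.le hθ) X
  have hN : nuclearNorm X ≤ (c - t * θ * l1Norm X) / t := nuclearNorm_le fun Y hY => by
    have h1 := hf (t • Y + Z) ⟨t • Y, (spectralNorm_smul_le ht.le Y).trans
      (mul_le_of_le_one_right ht.le hY), Z, hZ, rfl⟩
    rw [hX', mInner_add_left, mInner_smul_left, hZX] at h1
    rw [mInner_comm, le_div_iff₀ ht]
    linarith
  rw [le_div_iff₀ ht] at hN
  have h2 := hA X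
  rw [hX'] at hfA
  rw [thetaNorm] at h2
  linarith

theorem spectralNorm_le_of_abs_le {Z : Matrix (Fin m) (Fin n) ℝ} {c : ℝ} (hc : 0 ≤ c)
    (hZ : ∀ i j, |Z i j| ≤ c) : spectralNorm Z ≤ c * √(m * n) := by
  refine spectralNorm_le_of_mInner_self_le (by positivity) ?_
  rw [mul_pow, Real.sq_sqrt (by positivity)]
  calc mInner Z Z ≤ ∑ _i : Fin m, ∑ _j : Fin n, c ^ 2 :=
        Finset.sum_le_sum fun i _ => Finset.sum_le_sum fun j _ => by
          rw [← sq, ← sq_abs]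
          exact pow_le_pow_left₀ (abs_nonneg _) (hZ i j) 2
    _ = c ^ 2 * (m * n) := by simp; ring

theorem sigma2_nonneg (A : Matrix (Fin m) (Fin n) ℝ) : 0 ≤ sigma2 A :=
  Real.sInf_nonneg (by rintro _ ⟨S, _, rfl⟩; exact spectralNorm_nonneg _)

theorem exists_spectralNorm_sub_lt {A : Matrix (Fin m) (Fin n) ℝ} {c : ℝ} (h : sigma2 A < c) :
    ∃ S : Matrix (Fin m) (Fin n) ℝ, S.rank ≤ 1 ∧ spectralNorm (A - S) < c := by
  obtain ⟨_, ⟨S, hS, rfl⟩, hlt⟩ := exists_lt_of_csInf_lt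
    (⟨_, 0, by simp, rfl⟩ :
      {r | ∃ S : Matrix (Fin m) (Fin n) ℝ, S.rank ≤ 1 ∧ r = spectralNorm (A - S)}.Nonempty) h
  exact ⟨S, hS, hlt⟩

theorem rank_smul_vecMulVec_eq_one {r : ℝ} {u : Fin m → ℝ} {v : Fin n → ℝ}
    (h : r • vecMulVec u v ≠ 0) : (r • vecMulVec u v).rank = 1 := by
  have h1 : (r • vecMulVec u v).rank ≤ 1 := by
    rw [← smul_vecMulVec]
    exact rank_vecMulVec_le _ _
  refine le_antisymm h1 (Nat.one_le_iff_ne_zero.2 fun h0 => h ?_)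
  rw [Matrix.rank, Submodule.finrank_eq_zero, LinearMap.range_eq_bot] at h0
  ext i j
  have h2 := congrFun (LinearMap.congr_fun h0 (Pi.single j 1)) i
  simpa using h2

theorem stmt11 (A : Matrix (Fin m) (Fin n) ℝ)
    (hgap : sigma2 A < spectralNorm A) (θ : ℝ) (hθ0 : 0 ≤ θ)
    (hθA : θ < (1 / Real.sqrt (m * n)) *
      ((spectralNorm A - sigma2 A) / (3 * spectralNorm A - sigma2 A))) :
    ∃ X : Matrix (Fin m) (Fin n) ℝ, IsOptMax (thetaNorm θ) A X ∧ X.rank = 1 ∧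
      ∀ X', IsOptMax (thetaNorm θ) A X' → X' = X := by
  have hσ2 := sigma2_nonneg A
  have hσ1 : 0 < spectralNorm A := hσ2.trans_lt hgap
  obtain ⟨X, hX⟩ := exists_isOptMax hθ0 A
  set t := mInner A X with ht_def
  have hdom : ∀ W, mInner A W ≤ t * thetaNorm θ W := hX.mInner_le hθ0
  have ht : 0 < t := by
    obtain ⟨u, v, _, _, huv, _⟩ := exists_spectralNorm_eq A
    have h1 := hdom (vecMulVec u v)
    rw [mInner_vecMulVec, huv] at h1
    exact pos_of_mul_pos_left (hσ1.trans_le h1) (thetaNorm_nonneg hθ0 _)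
  have htσ : t ≤ spectralNorm A := by
    have h1 : nuclearNorm X + θ * l1Norm X ≤ 1 := hX.1
    exact (mInner_le_mul_nuclearNorm hσ1 le_rfl X).trans (mul_le_of_le_one_right hσ1.le
      (by linarith [mul_nonneg hθ0 (l1Norm_nonneg X)]))
  obtain ⟨Y, Z, hY, hZ, hYZ⟩ := exists_add_eq_of_mInner_le hθ0 ht hdom
  set δ := t * θ * √(m * n) with hδ_def
  have hZδ : spectralNorm Z ≤ δ := spectralNorm_le_of_abs_le (mul_nonneg ht.le hθ0) hZ
  have hδ : 2 * δ < spectralNorm A - sigma2 A := by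
    have hpos : 0 < √((m : ℝ) * n) := by
      refine (Real.sqrt_nonneg _).lt_of_ne' fun h0 => ?_
      rw [h0] at hθA
      simp at hθA
      linarith
    rw [one_div_mul_eq_div, lt_div_iff₀ hpos, lt_div_iff₀ (by linarith)] at hθA
    have h1 : δ ≤ spectralNorm A * (θ * √(m * n)) := by
      rw [hδ_def, mul_assoc]
      exact mul_le_mul_of_nonneg_right htσ (by positivity)
    have h2 : 0 ≤ θ * √((m : ℝ) * n) := by positivity
    nlinarith
  have hAt : spectralNorm A ≤ t + δ := hYZ ▸ (spectralNorm_add_le Y Z).trans (add_le_add hY hZδ)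
  obtain ⟨S, hS, hAS⟩ := exists_spectralNorm_sub_lt (A := A) (c := spectralNorm A - 2 * δ)
    (by linarith)
  have hYS : spectralNorm (Y - S) < t := by
    have h1 : Y - S = (A - S) + -Z := by rw [← hYZ]; abel
    rw [h1]
    linarith [spectralNorm_add_le (A - S) (-Z), spectralNorm_neg_le Z]
  obtain ⟨τ, hτ, hτt⟩ := exists_between (max_lt ht hYS)
  have hopt : ∀ W, IsOptMax (thetaNorm θ) A W →
      mInner A W = t ∧ mInner Y W = t * nuclearNorm W := by
    intro W hW
    have h1 : mInner A W = t := le_antisymm (hX.2 W hW.1) (hW.2 X hX.1)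
    have h2 : nuclearNorm W + θ * l1Norm W ≤ 1 := hW.1
    have h3 := mInner_le_mul_nuclearNorm ht hY W
    have h4 := mInner_le_of_abs_le hZ W
    have h5 : mInner Y W + mInner Z W = t := by rw [← mInner_add_left, hYZ, h1]
    exact ⟨h1, le_antisymm h3 (by nlinarith)⟩
  have hX0 : X ≠ 0 := by
    rintro rfl
    simp [mInner, ht_def] at ht
  obtain ⟨u, v, hu, hv, huv, _⟩ := exists_spectralNorm_eq Y
  have hYt : spectralNorm Y = t := by
    have hN : 0 < nuclearNorm X :=
      (nuclearNorm_nonneg X).lt_of_ne' fun h => hX0 (eq_zero_of_nuclearNorm_nonpos h.le)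
    rcases (spectralNorm_nonneg Y).eq_or_lt with h0 | h0
    · have h1 := mInner_le_mul_nuclearNorm (half_pos ht) (h0.symm.le.trans (half_pos ht).le) X
      rw [(hopt X hX).2] at h1
      nlinarith
    · have h1 := mInner_le_mul_nuclearNorm h0 le_rfl X
      rw [(hopt X hX).2] at h1
      exact le_antisymm hY (le_of_mul_le_mul_right h1 hN)
  have hform : ∀ W, IsOptMax (thetaNorm θ) A W → W = nuclearNorm W • vecMulVec u v := fun W hW =>
    eq_smul_vecMulVec_of_mInner_eq hY hS ((le_max_left _ _).trans_lt hτ) hτt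
      ((le_max_right _ _).trans hτ.le) hu hv (huv.trans hYt) (hopt W hW).2
  refine ⟨X, hX, ?_, fun W hW => ?_⟩
  · rw [hform X hX] at hX0 ⊢
    exact rank_smul_vecMulVec_eq_one hX0
  · have h1 := (hopt W hW).1
    have h2 := (hopt X hX).1
    rw [hform W hW, mInner_smul_right] at h1
    rw [hform X hX, mInner_smul_right] at h2
    have h3 : mInner A (vecMulVec u v) ≠ 0 := fun h => by
      rw [h, mul_zero] at h1
      exact ht.ne h1
    rw [hform W hW, hform X hX, mul_right_cancel₀ h3 (h1.trans h2.symm)]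

end LAROS
end
end

section
/- Let A be a nonzero entrywise nonnegative m×n real matrix and θ ≥ 0. If the problem: maximize ⟨A,X⟩ subject to ‖X‖_θ ≤ 1, has a rank-one optimal solution, then it has a rank-one optimal solution whose entries are all nonnegative. -/
open scoped BigOperators

noncomputable section

namespace LAROS

variable {m n : ℕ}

/-- Multiply row `i` of `X` by `s i` and column `j` by `t j`. -/
def rowColScale (s : Fin m → ℝ) (t : Fin n → ℝ) (X : Matrix (Fin m) (Fin n) ℝ) :
    Matrix (Fin m) (Fin n) ℝ :=
  Matrix.diagonal s * X * Matrix.diagonal t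

theorem rowColScale_apply (s : Fin m → ℝ) (t : Fin n → ℝ) (X : Matrix (Fin m) (Fin n) ℝ)
    (i : Fin m) (j : Fin n) : rowColScale s t X i j = s i * X i j * t j := by
  simp [rowColScale]

theorem mInner_rowColScale (s : Fin m → ℝ) (t : Fin n → ℝ) (A X : Matrix (Fin m) (Fin n) ℝ) :
    mInner (rowColScale s t A) X = mInner A (rowColScale s t X) := by
  simp only [mInner, rowColScale_apply]
  exact Finset.sum_congr rfl fun i _ => Finset.sum_congr rfl fun j _ => by ring

section Signs

variable {s : Fin m → ℝ} {t : Fin n → ℝ}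

theorem rowColScale_rowColScale (hs : ∀ i, s i * s i = 1) (ht : ∀ j, t j * t j = 1)
    (X : Matrix (Fin m) (Fin n) ℝ) : rowColScale s t (rowColScale s t X) = X := by
  ext i j
  simp only [rowColScale_apply]
  linear_combination X i j * (t j * t j) * hs i + X i j * ht j

theorem rank_rowColScale (hs : ∀ i, s i * s i = 1) (ht : ∀ j, t j * t j = 1)
    (X : Matrix (Fin m) (Fin n) ℝ) : (rowColScale s t X).rank = X.rank := by
  have hle (Y : Matrix (Fin m) (Fin n) ℝ) : (rowColScale s t Y).rank ≤ Y.rank :=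
    (Matrix.rank_mul_le_left _ _).trans (Matrix.rank_mul_le_right _ _)
  refine (hle X).antisymm ?_
  simpa only [rowColScale_rowColScale hs ht] using hle (rowColScale s t X)

theorem spectralNorm_rowColScale (hs : ∀ i, s i * s i = 1) (ht : ∀ j, t j * t j = 1)
    (X : Matrix (Fin m) (Fin n) ℝ) : spectralNorm (rowColScale s t X) = spectralNorm X := by
  have hsu (u : Fin m → ℝ) : ∑ i, (s i * u i) ^ 2 = ∑ i, u i ^ 2 :=
    Finset.sum_congr rfl fun i _ => by linear_combination u i ^ 2 * hs i
  have htv (v : Fin n → ℝ) : ∑ j, (t j * v j) ^ 2 = ∑ j, v j ^ 2 :=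
    Finset.sum_congr rfl fun j _ => by linear_combination v j ^ 2 * ht j
  unfold spectralNorm
  congr 1
  ext r
  constructor
  · rintro ⟨u, v, hu, hv, rfl⟩
    refine ⟨fun i => s i * u i, fun j => t j * v j, (hsu u).trans_le hu, (htv v).trans_le hv, ?_⟩
    refine Finset.sum_congr rfl fun i _ => Finset.sum_congr rfl fun j _ => ?_
    rw [rowColScale_apply]
    ring
  · rintro ⟨u, v, hu, hv, rfl⟩
    refine ⟨fun i => s i * u i, fun j => t j * v j, (hsu u).trans_le hu, (htv v).trans_le hv, ?_⟩
    refine Finset.sum_congr rfl fun i _ => Finset.sum_congr rfl fun j _ => ?_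
    rw [rowColScale_apply]
    linear_combination -(u i * X i j * v j * (t j * t j)) * hs i - u i * X i j * v j * ht j

theorem nuclearNorm_rowColScale (hs : ∀ i, s i * s i = 1) (ht : ∀ j, t j * t j = 1)
    (X : Matrix (Fin m) (Fin n) ℝ) : nuclearNorm (rowColScale s t X) = nuclearNorm X := by
  unfold nuclearNorm dualNorm
  congr 1
  ext r
  constructor
  · rintro ⟨Y, hY, rfl⟩
    exact ⟨rowColScale s t Y, (spectralNorm_rowColScale hs ht Y).trans_le hY,
      mInner_rowColScale s t X Y⟩
  · rintro ⟨Y, hY, rfl⟩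
    refine ⟨rowColScale s t Y, (spectralNorm_rowColScale hs ht Y).trans_le hY, ?_⟩
    rw [mInner_rowColScale, rowColScale_rowColScale hs ht]

theorem l1Norm_rowColScale (hs : ∀ i, s i * s i = 1) (ht : ∀ j, t j * t j = 1)
    (X : Matrix (Fin m) (Fin n) ℝ) : l1Norm (rowColScale s t X) = l1Norm X := by
  have habs {a : ℝ} (ha : a * a = 1) : |a| = 1 := by
    rcases mul_self_eq_one_iff.mp ha with rfl | rfl <;> simp
  simp [l1Norm, rowColScale_apply, abs_mul, habs (hs _), habs (ht _)]

theorem thetaNorm_rowColScale (hs : ∀ i, s i * s i = 1) (ht : ∀ j, t j * t j = 1) (θ : ℝ)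
    (X : Matrix (Fin m) (Fin n) ℝ) : thetaNorm θ (rowColScale s t X) = thetaNorm θ X := by
  rw [thetaNorm, thetaNorm, nuclearNorm_rowColScale hs ht, l1Norm_rowColScale hs ht]

end Signs

theorem exists_eq_vecMulVec_of_rank_eq_one {X : Matrix (Fin m) (Fin n) ℝ} (hX : X.rank = 1) :
    ∃ (u : Fin m → ℝ) (v : Fin n → ℝ), X = Matrix.vecMulVec u v := by
  rw [Matrix.rank_eq_finrank_span_cols] at hX
  obtain ⟨u, -, hu⟩ := finrank_eq_one_iff'.mp hX
  choose v hv using fun j => hu ⟨X.col j, Submodule.subset_span ⟨j, rfl⟩⟩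
  refine ⟨u, v, ?_⟩
  ext i j
  have h := congrFun (congrArg Subtype.val (hv j)) i
  simpa [Matrix.vecMulVec_apply, mul_comm] using h.symm

theorem exists_sign_mul_eq_abs {ι : Type*} (u : ι → ℝ) :
    ∃ s : ι → ℝ, (∀ i, s i * s i = 1) ∧ ∀ i, s i * u i = |u i| := by
  refine ⟨fun i => if u i < 0 then -1 else 1, fun i => ?_, fun i => ?_⟩
  · dsimp only
    split_ifs <;> norm_num
  · dsimp only
    split_ifs with h
    · rw [abs_of_neg h, neg_one_mul]
    · rw [abs_of_nonneg (not_lt.mp h), one_mul]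

theorem stmt12 (θ : ℝ) (hθ : 0 ≤ θ) (A : Matrix (Fin m) (Fin n) ℝ)
    (hA0 : A ≠ 0) (hAnn : ∀ i j, 0 ≤ A i j)
    (hex : ∃ X : Matrix (Fin m) (Fin n) ℝ, IsOptMax (thetaNorm θ) A X ∧ X.rank = 1) :
    ∃ X : Matrix (Fin m) (Fin n) ℝ, IsOptMax (thetaNorm θ) A X ∧ X.rank = 1 ∧
      ∀ i j, 0 ≤ X i j := by
  obtain ⟨X, ⟨hX, hmax⟩, hrank⟩ := hex
  obtain ⟨u, v, hXuv⟩ := exists_eq_vecMulVec_of_rank_eq_one hrank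
  obtain ⟨s, hs, hsu⟩ := exists_sign_mul_eq_abs u
  obtain ⟨t, ht, htv⟩ := exists_sign_mul_eq_abs v
  have habs (i : Fin m) (j : Fin n) : rowColScale s t X i j = |X i j| := by
    rw [rowColScale_apply, hXuv, Matrix.vecMulVec_apply, abs_mul, ← hsu, ← htv]
    ring
  have hle : mInner A X ≤ mInner A (rowColScale s t X) := by
    refine Finset.sum_le_sum fun i _ => Finset.sum_le_sum fun j _ => ?_
    rw [habs]
    exact mul_le_mul_of_nonneg_left (le_abs_self _) (hAnn i j)
  exact ⟨rowColScale s t X,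
    ⟨(thetaNorm_rowColScale hs ht θ X).trans_le hX, fun Y hY => (hmax Y hY).trans hle⟩,
    (rank_rowColScale hs ht X).trans hrank, fun i j => (habs i j).symm ▸ abs_nonneg _⟩

end LAROS
end
end
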